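/- arXiv:math/0603242 — 3 statements merged into one kernel-verified Lean document; each statement's English description precedes it below -/
import Mathlib

section
/- Let a, b be real numbers. There exists a nonzero vector x = (x₀,x₁,x₂,x₃,x₄) ∈ ℂ⁵ satisfying σ(x) = x, x₁x₂ = a·x₀², and x₃x₄ = b·x₀² if and only if a ≥ 0 and b ≥ 0. (This is Lemma 2.4(ii) of the paper: the quartic surface {x₁x₂ = a x₀², x₃x₄ = b x₀²} in ℂP⁴ has a real point with respect to the twistor real structure iff a ≥ 0 and b ≥ 0.) -/
/-- The real structure `σ(x₀,x₁,x₂,x₃,x₄) = (conj x₀, conj x₂, conj x₁, conj x₄, conj x₃)`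
on `ℂ⁵`. -/
def sigma5 (x : Fin 5 → ℂ) : Fin 5 → ℂ :=
  ![(starRingEnd ℂ) (x 0), (starRingEnd ℂ) (x 2), (starRingEnd ℂ) (x 1),
    (starRingEnd ℂ) (x 4), (starRingEnd ℂ) (x 3)]

/-- Lemma 2.4(ii): the quartic surface `{x₁x₂ = a x₀², x₃x₄ = b x₀²}` has a real point
with respect to the twistor real structure iff `a ≥ 0` and `b ≥ 0`. -/
theorem stmt0 (a b : ℝ) :
    (∃ x : Fin 5 → ℂ, x ≠ 0 ∧ sigma5 x = x ∧
      x 1 * x 2 = (a : ℂ) * (x 0) ^ 2 ∧ x 3 * x 4 = (b : ℂ) * (x 0) ^ 2) ↔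
    0 ≤ a ∧ 0 ≤ b := by
  constructor
  · rintro ⟨x, hx, hs, h1, h2⟩
    have e0 : (starRingEnd ℂ) (x 0) = x 0 := congrFun hs 0
    have e2 : (starRingEnd ℂ) (x 1) = x 2 := congrFun hs 2
    have e4 : (starRingEnd ℂ) (x 3) = x 4 := congrFun hs 4
    obtain ⟨r, hr⟩ := Complex.conj_eq_iff_real.mp e0
    rw [← e2, hr, Complex.mul_conj] at h1
    rw [← e4, hr, Complex.mul_conj] at h2
    have h1' : Complex.normSq (x 1) = a * r ^ 2 := by exact_mod_cast h1
    have h2' : Complex.normSq (x 3) = b * r ^ 2 := by exact_mod_cast h2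
    have hr0 : r ≠ 0 := by
      rintro rfl
      have z1 : x 1 = 0 := Complex.normSq_eq_zero.mp (by simpa using h1')
      have z3 : x 3 = 0 := Complex.normSq_eq_zero.mp (by simpa using h2')
      apply hx
      funext i
      fin_cases i
      · simpa using hr
      · simpa using z1
      · simpa [z1] using e2.symm
      · simpa using z3
      · simpa [z3] using e4.symm
    have hp : 0 < r ^ 2 := by positivity
    exact ⟨nonneg_of_mul_nonneg_left (h1' ▸ Complex.normSq_nonneg _) hp,
      nonneg_of_mul_nonneg_left (h2' ▸ Complex.normSq_nonneg _) hp⟩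
  · rintro ⟨ha, hb⟩
    have sa : ((√a : ℝ) : ℂ) * ((√a : ℝ) : ℂ) = a := by
      exact_mod_cast Real.mul_self_sqrt ha
    have sb : ((√b : ℝ) : ℂ) * ((√b : ℝ) : ℂ) = b := by
      exact_mod_cast Real.mul_self_sqrt hb
    refine ⟨![1, (√a : ℝ), (√a : ℝ), (√b : ℝ), (√b : ℝ)], ?_, ?_, ?_, ?_⟩
    · intro h
      have := congrFun h 0
      simp at this
    · funext i
      fin_cases i <;> simp [sigma5]
    · simpa using sa
    · simpa using sb
end

section
/- Let a, b be nonzero complex numbers. For a nonzero vector x = (x₀,x₁,x₂,x₃,x₄) ∈ ℂ⁵ satisfying x₁x₂ = a·x₀² and x₃x₄ = b·x₀², the two gradient vectors v₁(x) = (−2a·x₀, x₂, x₁, 0, 0) and v₂(x) = (−2b·x₀, 0, 0, x₄, x₃) are linearly dependent over ℂ if and only if x is a nonzero scalar multiple of one of the standard basis vectors e₁, e₂, e₃, e₄ of ℂ⁵. (This identifies the singular locus of the quartic surface {x₁x₂ = a x₀², x₃x₄ = b x₀²} ⊂ ℂP⁴ as exactly the four coordinate points [0:1:0:0:0], [0:0:1:0:0],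 [0:0:0:1:0], [0:0:0:0:1], as asserted in Lemma 2.4(i).) -/
/-- Lemma 2.4(i): on the quartic surface `{x₁x₂ = a x₀², x₃x₄ = b x₀²}` (with `a, b ≠ 0`),
the two Jacobian rows are linearly dependent exactly at the four coordinate points
`[0:1:0:0:0], [0:0:1:0:0], [0:0:0:1:0], [0:0:0:0:1]`. -/
theorem stmt2 (a b : ℂ) (ha : a ≠ 0) (hb : b ≠ 0) (x : Fin 5 → ℂ) (hx : x ≠ 0)
    (h1 : x 1 * x 2 = a * (x 0) ^ 2) (h2 : x 3 * x 4 = b * (x 0) ^ 2) :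
    ¬ LinearIndependent ℂ
        ![(![-(2 * a * x 0), x 2, x 1, 0, 0] : Fin 5 → ℂ),
          (![-(2 * b * x 0), 0, 0, x 4, x 3] : Fin 5 → ℂ)] ↔
      ∃ c : ℂ, c ≠ 0 ∧
        (x = c • (Pi.single (1 : Fin 5) (1 : ℂ) : Fin 5 → ℂ) ∨
         x = c • (Pi.single (2 : Fin 5) (1 : ℂ) : Fin 5 → ℂ) ∨
         x = c • (Pi.single (3 : Fin 5) (1 : ℂ) : Fin 5 → ℂ) ∨
         x = c • (Pi.single (4 : Fin 5) (1 : ℂ) : Fin 5 → ℂ)) := by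
  rw [LinearIndependent.pair_iff]
  have key : ∀ i : Fin 5, (∀ j, j ≠ i → x j = 0) →
      x i ≠ 0 ∧ x = x i • (Pi.single i (1 : ℂ) : Fin 5 → ℂ) := by
    intro i hi
    have he : x = x i • (Pi.single i (1 : ℂ) : Fin 5 → ℂ) := by
      funext j
      by_cases hj : j = i
      · subst hj; simp
      · simp [hi j hj, hj]
    refine ⟨fun h => hx ?_, he⟩
    rw [he, h, zero_smul]
  constructor
  · intro h
    push Not at h
    obtain ⟨s, t, hst, hne⟩ := h
    have e1 := congrFun hst 1
    have e2 := congrFun hst 2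
    have e3 := congrFun hst 3
    have e4 := congrFun hst 4
    simp at e1 e2 e3 e4
    by_cases hs : s = 0
    · have ht := hne hs
      have h4 : x 4 = 0 := e3.resolve_left ht
      have h3 : x 3 = 0 := e4.resolve_left ht
      have h0 : x 0 = 0 := by simpa [h3, hb] using h2
      have h12 : x 1 = 0 ∨ x 2 = 0 := by simpa [h0] using h1
      rcases h12 with h | h
      · obtain ⟨hc, he⟩ := key 2 (by intro j hj; fin_cases j <;> first | exact absurd rfl hj | assumption)
        exact ⟨_, hc, Or.inr (Or.inl he)⟩
      · obtain ⟨hc, he⟩ := key 1 (by intro j hj; fin_cases j <;> first | exact absurd rfl hj | assumption)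
        exact ⟨_, hc, Or.inl he⟩
    · have h5 : x 2 = 0 := e1.resolve_left hs
      have h6 : x 1 = 0 := e2.resolve_left hs
      have h0 : x 0 = 0 := by simpa [h6, ha] using h1
      have h34 : x 3 = 0 ∨ x 4 = 0 := by simpa [h0] using h2
      rcases h34 with h | h
      · obtain ⟨hc, he⟩ := key 4 (by intro j hj; fin_cases j <;> first | exact absurd rfl hj | assumption)
        exact ⟨_, hc, Or.inr (Or.inr (Or.inr he))⟩
      · obtain ⟨hc, he⟩ := key 3 (by intro j hj; fin_cases j <;> first | exact absurd rfl hj | assumption)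
        exact ⟨_, hc, Or.inr (Or.inr (Or.inl he))⟩
  · rintro ⟨c, hc, h | h | h | h⟩ hl
    · have := (hl 0 1 (by subst h; funext j; fin_cases j <;> simp)).2
      exact one_ne_zero this
    · have := (hl 0 1 (by subst h; funext j; fin_cases j <;> simp)).2
      exact one_ne_zero this
    · have := (hl 1 0 (by subst h; funext j; fin_cases j <;> simp)).1
      exact one_ne_zero this
    · have := (hl 1 0 (by subst h; funext j; fin_cases j <;> simp)).1
      exact one_ne_zero this
end

section
/- Let λ₁ < λ₂ < λ₃ < λ₄ < λ₅ < λ₆ be distinct real numbers and set f₁(λ) = −(λ−λ₁)(λ−λ₂)(λ−λ₃)(λ−λ₄) and f₂(λ) = (λ−λ₁)(λ−λ₄)(λ−λ₅)(λ−λ₆). Consider the affine 3-fold Y = { (ξ₁,ξ₂,ξ₃,ξ₄,λ) ∈ ℂ⁵ : ξ₁ξ₂ = f₁(λ), ξ₃ξ₄ = f₂(λ) }. A point of Y is singular (i.e. the two Jacobian rows (ξ₂, ξ₁, 0, 0, −f₁′(λ)) and (0, 0, ξ₄, ξ₃, −f₂′(λ)) are linearly dependent over ℂ) if and only if it is one of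 the two points (0,0,0,0,λ₁) and (0,0,0,0,λ₄). -/
lemma quartic_simple (k a b c d z : ℂ) (hk : k ≠ 0) (hab : a ≠ b) (hac : a ≠ c) (had : a ≠ d)
    (hbc : b ≠ c) (hbd : b ≠ d) (hcd : c ≠ d) (g : ℂ → ℂ)
    (hg : ∀ z, g z = k * ((z - a) * (z - b) * (z - c) * (z - d)))
    (h0 : g z = 0) : deriv g z ≠ 0 := by
  have hd : HasDerivAt g (k * (((1 * (z - b) + (z - a) * 1) * (z - c) + (z - a) * (z - b) * 1)
      * (z - d) + (z - a) * (z - b) * (z - c) * 1)) z := by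
    rw [show g = fun z => k * ((z - a) * (z - b) * (z - c) * (z - d)) from funext hg]
    have h (u : ℂ) : HasDerivAt (fun z : ℂ => z - u) 1 z := (hasDerivAt_id z).sub_const u
    exact ((((h a).mul (h b)).mul (h c)).mul (h d)).const_mul k
  rw [hd.deriv]
  rw [hg] at h0
  have e (u v : ℂ) (h : u ≠ v) : u - v ≠ 0 := sub_ne_zero.mpr h
  have h1 := e _ _ hab
  have h2 := e _ _ hac
  have h3 := e _ _ had
  have h4 := e _ _ hbc
  have h5 := e _ _ hbd
  have h6 := e _ _ hcd
  have h1' := e _ _ hab.symm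
  have h2' := e _ _ hac.symm
  have h3' := e _ _ had.symm
  have h4' := e _ _ hbc.symm
  have h5' := e _ _ hbd.symm
  have h6' := e _ _ hcd.symm
  simp only [mul_eq_zero, hk, false_or, sub_eq_zero] at h0
  rcases h0 with ((h0 | h0) | h0) | h0 <;> subst h0 <;> simp [*]

/-- The singular points of the 3-fold `Y = {ξ₁ξ₂ = f₁(λ), ξ₃ξ₄ = f₂(λ)}`, with
`f₁(λ) = −(λ−λ₁)(λ−λ₂)(λ−λ₃)(λ−λ₄)` and `f₂(λ) = (λ−λ₁)(λ−λ₄)(λ−λ₅)(λ−λ₆)`, are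
exactly the two points `(0,0,0,0,λ₁)` and `(0,0,0,0,λ₄)`. -/
theorem stmt8 (l₁ l₂ l₃ l₄ l₅ l₆ : ℝ)
    (h12 : l₁ < l₂) (h23 : l₂ < l₃) (h34 : l₃ < l₄) (h45 : l₄ < l₅) (h56 : l₅ < l₆)
    (f₁ f₂ : ℂ → ℂ)
    (hf₁ : ∀ z : ℂ, f₁ z = -((z - l₁) * (z - l₂) * (z - l₃) * (z - l₄)))
    (hf₂ : ∀ z : ℂ, f₂ z = (z - l₁) * (z - l₄) * (z - l₅) * (z - l₆))
    (ξ₁ ξ₂ ξ₃ ξ₄ lam : ℂ)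
    (h1 : ξ₁ * ξ₂ = f₁ lam) (h2 : ξ₃ * ξ₄ = f₂ lam) :
    ¬ LinearIndependent ℂ
        ![(![ξ₂, ξ₁, 0, 0, -(deriv f₁ lam)] : Fin 5 → ℂ),
          (![0, 0, ξ₄, ξ₃, -(deriv f₂ lam)] : Fin 5 → ℂ)] ↔
      (ξ₁ = 0 ∧ ξ₂ = 0 ∧ ξ₃ = 0 ∧ ξ₄ = 0 ∧ (lam = (l₁ : ℂ) ∨ lam = (l₄ : ℂ))) := by
  have c (x y : ℝ) (h : x < y) : (x : ℂ) ≠ (y : ℂ) := by exact_mod_cast h.ne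
  have n1 : f₁ lam = 0 → deriv f₁ lam ≠ 0 := quartic_simple (-1) l₁ l₂ l₃ l₄ lam (by norm_num)
    (c _ _ (by linarith)) (c _ _ (by linarith)) (c _ _ (by linarith)) (c _ _ (by linarith))
    (c _ _ (by linarith)) (c _ _ (by linarith)) f₁ (fun z => by rw [hf₁]; ring)
  have n2 : f₂ lam = 0 → deriv f₂ lam ≠ 0 := quartic_simple 1 l₁ l₄ l₅ l₆ lam (by norm_num)
    (c _ _ (by linarith)) (c _ _ (by linarith)) (c _ _ (by linarith)) (c _ _ (by linarith))
    (c _ _ (by linarith)) (c _ _ (by linarith)) f₂ (fun z => by rw [hf₂]; ring)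
  rw [LinearIndependent.pair_iff]
  generalize deriv f₁ lam = p at *
  generalize deriv f₂ lam = q at *
  constructor
  · intro h
    push Not at h
    obtain ⟨s, t, hst, hne⟩ := h
    have e0 := congrFun hst 0
    have e1 := congrFun hst 1
    have e2 := congrFun hst 2
    have e3 := congrFun hst 3
    have e4 := congrFun hst 4
    simp at e0 e1 e2 e3 e4
    by_cases hs : s = 0
    · have ht := hne hs
      have h3 : ξ₃ = 0 := by tauto
      have hq : q = 0 := by simpa [hs, ht] using e4
      exact absurd hq (n2 (by rw [← h2, h3, zero_mul]))
    · have x1 : ξ₁ = 0 := by tauto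
      have x2 : ξ₂ = 0 := by tauto
      have z1 : f₁ lam = 0 := by rw [← h1, x1, zero_mul]
      by_cases ht : t = 0
      · have hp : p = 0 := by simpa [hs, ht] using e4
        exact absurd hp (n1 z1)
      · have x3 : ξ₃ = 0 := by tauto
        have x4 : ξ₄ = 0 := by tauto
        have z2 : f₂ lam = 0 := by rw [← h2, x3, zero_mul]
        refine ⟨x1, x2, x3, x4, ?_⟩
        rw [hf₁] at z1
        rw [hf₂] at z2
        simp only [neg_eq_zero, mul_eq_zero, sub_eq_zero] at z1 z2
        have a1 := c l₂ l₅ (by linarith)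
        have a2 := c l₂ l₆ (by linarith)
        have a3 := c l₃ l₅ (by linarith)
        have a4 := c l₃ l₆ (by linarith)
        grind
  · rintro ⟨x1, x2, x3, x4, -⟩ h
    have hq : q ≠ 0 := n2 (by rw [← h2, x3, zero_mul])
    have := (h q (-p) (by
      ext i
      fin_cases i <;> simp [x1, x2, x3, x4]
      ring)).1
    exact hq this
end
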